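/- arXiv:math/0206167 — 2 statements merged into one kernel-verified Lean document; each statement's English description precedes it below -/
import Mathlib

section
/- Let n be a positive integer and let X, Y, Z be non-empty subsets of [±n] such that: (1) Z = -Z, X ∩ (-X) = ∅, Y ∩ (-Y) = ∅; (2) the family of sets Z, X, -X is non-crossing; (3) the family of sets Z, Y, -Y is non-crossing; (4) Abs(X) = Abs(Y). Then either X = Y or X = -Y. -/
open scoped Classical

namespace NCPB

/-- A collection of subsets of `α` is a partition: blocks are nonempty and
every element lies in exactly one block. -/
def IsPartition {α : Type*} (P : Set (Set α)) : Prop :=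
  (∀ B ∈ P, B.Nonempty) ∧ ∀ a : α, ∃! B, B ∈ P ∧ a ∈ B

/-- The non-crossing condition for a collection of subsets of a linear order:
if `a < b < c < d`, `a, c` lie in a block `B` and `b, d` lie in a block `C`,
then `b ∈ B` (i.e. the blocks coincide). -/
def IsNC {α : Type*} [LinearOrder α] (P : Set (Set α)) : Prop :=
  ∀ B ∈ P, ∀ C ∈ P, ∀ a b c d : α, a < b → b < c → c < d →
    a ∈ B → c ∈ B → b ∈ C → d ∈ C → b ∈ B

/-- A non-crossing partition of a linear order. -/
def NCPart {α : Type*} [LinearOrder α] (P : Set (Set α)) : Prop :=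
  IsPartition P ∧ IsNC P

/-- The set `[±m] = {1 < 2 < ... < m < -1 < -2 < ... < -m}` is encoded as `Fin (2*m)`,
position `k < m` encoding `k+1` and position `m + j` encoding `-(j+1)`.
`negMap` is the inversion map `a ↦ -a`. -/
def negMap (m : ℕ) (k : Fin (2*m)) : Fin (2*m) :=
  ⟨(k.val + m) % (2*m), Nat.mod_lt _ (Nat.lt_of_le_of_lt (Nat.zero_le _) k.isLt)⟩

/-- Image of a subset of `[±m]` under the inversion map, i.e. `X ↦ -X`. -/
def negSet (m : ℕ) (X : Set (Fin (2*m))) : Set (Fin (2*m)) := negMap m '' X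

/-- The absolute value map `[±m] → {1,...,m}`, `±i ↦ i`. -/
def absMap (m : ℕ) (k : Fin (2*m)) : Fin m :=
  ⟨k.val % m, Nat.mod_lt _ (by have := k.isLt; omega)⟩

/-- A non-crossing partition of type B: a non-crossing partition of `[±m]`
invariant under the inversion map. -/
def NCBPart (m : ℕ) (π : Set (Set (Fin (2*m)))) : Prop :=
  NCPart π ∧ ∀ B ∈ π, negSet m B ∈ π

/-- The collection of sets `Abs(X)`, `X` a block of `π`. -/
def absPart (m : ℕ) (π : Set (Set (Fin (2*m)))) : Set (Set (Fin m)) :=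
  {F | ∃ X ∈ π, F = absMap m '' X}

/-- The embedding of `{1,...,m}` onto the odd-indexed positions of the interleaved
set `1 < 1̄ < 2 < 2̄ < ... < m < m̄` (encoded as `Fin (2*m)`): `i ↦ i` (even positions). -/
def evens (m : ℕ) (i : Fin m) : Fin (2*m) := ⟨2*i.val, by have := i.isLt; omega⟩

/-- The embedding of the barred copy `{1̄,...,m̄}` into the interleaved set: odd positions. -/
def odds (m : ℕ) (i : Fin m) : Fin (2*m) := ⟨2*i.val+1, by have := i.isLt; omega⟩

/-- `P` refines... rather: every block of `P` is contained in a block of `Q`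
(the partial order on partitions by reverse refinement: `P ≤ Q`). -/
def Refines {α : Type*} (P Q : Set (Set α)) : Prop := ∀ B ∈ P, ∃ C ∈ Q, B ⊆ C

/-- The collection `p ∪ q̄` of subsets of the interleaved set
`1 < 1̄ < 2 < 2̄ < ... < m < m̄`, with `p` living on the unbarred copy and `q` on the
barred copy. -/
def interleave (m : ℕ) (p q : Set (Set (Fin m))) : Set (Set (Fin (2*m))) :=
  ((fun B => evens m '' B) '' p) ∪ ((fun B => odds m '' B) '' q)

/-- `q` is the Kreweras complement of `p`: `q` is the largest non-crossing partition
(in the reverse-refinement order) such that `p ∪ q̄` is a non-crossing partition of the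
interleaved set `1 < 1̄ < ... < m < m̄`. -/
def IsKr (m : ℕ) (p q : Set (Set (Fin m))) : Prop :=
  NCPart q ∧ NCPart (interleave m p q) ∧
  ∀ q', NCPart q' → NCPart (interleave m p q') → Refines q' q

/-- Two sets cross: there are `a < b < c < d` with `a, c ∈ B` and `b, d ∈ C`. -/
def Crossing {α : Type*} [LinearOrder α] (B C : Set α) : Prop :=
  ∃ a b c d : α, a < b ∧ b < c ∧ c < d ∧ a ∈ B ∧ c ∈ B ∧ b ∈ C ∧ d ∈ C

/-- Two members of a non-crossing family of pairwise disjoint sets: disjoint,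
and neither crosses the other. -/
def PairNC {α : Type*} [LinearOrder α] (B C : Set α) : Prop :=
  Disjoint B C ∧ ¬ Crossing B C ∧ ¬ Crossing C B

end NCPB

namespace NCPB

theorem negMap_val_eq_add_or_sub {n : ℕ} (k : Fin (2 * n)) :
    (k.val < n ∧ (negMap n k).val = k.val + n) ∨
      (n ≤ k.val ∧ (negMap n k).val + n = k.val) := by
  have hk := k.isLt
  rcases lt_or_ge k.val n with h | h
  · exact Or.inl ⟨h, Nat.mod_eq_of_lt (by omega)⟩
  · refine Or.inr ⟨h, ?_⟩
    have hmod : (k.val + n) % (2 * n) = k.val - n := by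
      rw [Nat.mod_eq_sub_mod (by omega), Nat.mod_eq_of_lt (by omega)]
      omega
    simp only [negMap, hmod]
    omega

theorem absMap_val_eq_self_or_sub {n : ℕ} (k : Fin (2 * n)) :
    (k.val < n ∧ (absMap n k).val = k.val) ∨
      (n ≤ k.val ∧ (absMap n k).val + n = k.val) := by
  have hk := k.isLt
  rcases lt_or_ge k.val n with h | h
  · exact Or.inl ⟨h, Nat.mod_eq_of_lt h⟩
  · refine Or.inr ⟨h, ?_⟩
    have hmod : k.val % n = k.val - n := by
      rw [Nat.mod_eq_sub_mod h, Nat.mod_eq_of_lt (by omega)]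
    simp only [absMap, hmod]
    omega

theorem absMap_negMap {n : ℕ} (k : Fin (2 * n)) : absMap n (negMap n k) = absMap n k := by
  have h₁ := negMap_val_eq_add_or_sub k
  have h₂ := absMap_val_eq_self_or_sub k
  have h₃ := absMap_val_eq_self_or_sub (negMap n k)
  ext
  omega

theorem absMap_image_negSet {n : ℕ} (X : Set (Fin (2 * n))) :
    absMap n '' negSet n X = absMap n '' X := by
  simp only [negSet, Set.image_image, absMap_negMap]

theorem exists_val_lt_mem_negMap_mem {n : ℕ} {Z : Set (Fin (2 * n))} (hne : Z.Nonempty)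
    (hZ : negSet n Z = Z) : ∃ z ∈ Z, z.val < n ∧ negMap n z ∈ Z := by
  obtain ⟨z, hz⟩ := hne
  have hneg : ∀ k ∈ Z, negMap n k ∈ Z := fun k hk => hZ ▸ Set.mem_image_of_mem _ hk
  rcases negMap_val_eq_add_or_sub z with h | h
  · exact ⟨z, hz, h.1, hneg z hz⟩
  · exact ⟨negMap n z, hneg z hz, by omega, hneg _ (hneg z hz)⟩

theorem PairNC.subset_Ioo_or_subset_compl_Icc {α : Type*} [LinearOrder α] {Z X : Set α}
    (h : PairNC Z X) {a b : α} (ha : a ∈ Z) (hb : b ∈ Z) :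
    X ⊆ Set.Ioo a b ∨ X ⊆ (Set.Icc a b)ᶜ := by
  obtain ⟨hd, hZX, hXZ⟩ := h
  have hne : ∀ x ∈ X, ∀ z ∈ Z, x ≠ z := fun x hx z hz hxz =>
    Set.disjoint_left.1 hd hz (hxz ▸ hx)
  by_contra! hcon
  obtain ⟨h₁, h₂⟩ := hcon
  obtain ⟨x, hx, hxo⟩ := Set.not_subset.1 h₁
  obtain ⟨y, hy, hyi⟩ := Set.not_subset.1 h₂
  obtain ⟨hay, hyb⟩ := Set.notMem_compl_iff.1 hyi
  replace hay := lt_of_le_of_ne hay (hne y hy a ha).symm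
  replace hyb := lt_of_le_of_ne hyb (hne y hy b hb)
  rcases lt_or_gt_of_ne (hne x hx a ha) with hxa | hax
  · exact hXZ ⟨x, a, y, b, hxa, hay, hyb, hx, hy, ha, hb⟩
  · have hbx : b < x := lt_of_le_of_ne (not_lt.1 fun hxb => hxo ⟨hax, hxb⟩) (hne x hx b hb).symm
    exact hZX ⟨a, y, b, x, hay, hyb, hbx, ha, hb, hy, hx⟩

theorem absMap_injOn_Ioo {n : ℕ} {z : Fin (2 * n)} (hz : z.val < n) :
    Set.InjOn (absMap n) (Set.Ioo z (negMap n z)) := by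
  rintro x ⟨hx₁, hx₂⟩ y ⟨hy₁, hy₂⟩ hxy
  have h₁ := negMap_val_eq_add_or_sub z
  have h₂ := absMap_val_eq_self_or_sub x
  have h₃ := absMap_val_eq_self_or_sub y
  rw [hxy] at h₂
  rw [Fin.lt_def] at hx₁ hx₂ hy₁ hy₂
  ext
  omega

theorem absMap_injOn_compl_Icc {n : ℕ} {z : Fin (2 * n)} (hz : z.val < n) :
    Set.InjOn (absMap n) (Set.Icc z (negMap n z))ᶜ := by
  intro x hx y hy hxy
  have h₁ := negMap_val_eq_add_or_sub z
  have h₂ := absMap_val_eq_self_or_sub x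
  have h₃ := absMap_val_eq_self_or_sub y
  rw [hxy] at h₂
  simp only [Set.mem_compl_iff, Set.mem_Icc, Fin.le_def] at hx hy
  ext
  omega

theorem negSet_subset_compl_Icc {n : ℕ} {z : Fin (2 * n)} (hz : z.val < n)
    {X : Set (Fin (2 * n))} (hX : X ⊆ Set.Ioo z (negMap n z)) :
    negSet n X ⊆ (Set.Icc z (negMap n z))ᶜ := by
  rintro _ ⟨x, hx, rfl⟩
  obtain ⟨hx₁, hx₂⟩ := hX hx
  have h₁ := negMap_val_eq_add_or_sub z
  have h₂ := negMap_val_eq_add_or_sub x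
  rw [Fin.lt_def] at hx₁ hx₂
  simp only [Set.mem_compl_iff, Set.mem_Icc, Fin.le_def]
  omega

theorem negSet_subset_Ioo {n : ℕ} {z : Fin (2 * n)} (hz : z.val < n)
    {X : Set (Fin (2 * n))} (hX : X ⊆ (Set.Icc z (negMap n z))ᶜ) :
    negSet n X ⊆ Set.Ioo z (negMap n z) := by
  rintro _ ⟨x, hx, rfl⟩
  have hx' := hX hx
  have hlt := x.isLt
  have h₁ := negMap_val_eq_add_or_sub z
  have h₂ := negMap_val_eq_add_or_sub x
  simp only [Set.mem_compl_iff, Set.mem_Icc, Fin.le_def] at hx'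
  simp only [Set.mem_Ioo, Fin.lt_def]
  omega

end NCPB

open NCPB in
/-- Let `X, Y, Z` be non-empty subsets of `[±n]` with `Z = -Z`,
`X ∩ (-X) = ∅`, `Y ∩ (-Y) = ∅`, such that the family `Z, X, -X` is non-crossing
(pairwise disjoint, no two of them cross) and likewise the family `Z, Y, -Y`, and
`Abs(X) = Abs(Y)`. Then `X = Y` or `X = -Y`. -/
theorem blocks_eq_or_eq_neg_of_absSet_eq (n : ℕ) (hn : 0 < n) (X Y Z : Set (Fin (2*n)))
    (hXne : X.Nonempty) (hYne : Y.Nonempty) (hZne : Z.Nonempty)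
    (hZ : negSet n Z = Z) (hX : X ∩ negSet n X = ∅) (hY : Y ∩ negSet n Y = ∅)
    (hZX : PairNC Z X) (hZnX : PairNC Z (negSet n X)) (hXnX : PairNC X (negSet n X))
    (hZY : PairNC Z Y) (hZnY : PairNC Z (negSet n Y)) (hYnY : PairNC Y (negSet n Y))
    (habs : absMap n '' X = absMap n '' Y) :
    X = Y ∨ X = negSet n Y := by
  obtain ⟨z, hz, hzn, hnz⟩ := exists_val_lt_mem_negMap_mem hZne hZ
  have habs' : absMap n '' X = absMap n '' negSet n Y := habs.trans (absMap_image_negSet Y).symm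
  rcases hZX.subset_Ioo_or_subset_compl_Icc hz hnz with hXs | hXs <;>
    rcases hZY.subset_Ioo_or_subset_compl_Icc hz hnz with hYs | hYs
  · exact Or.inl (((absMap_injOn_Ioo hzn).image_eq_image_iff hXs hYs).1 habs)
  · exact Or.inr (((absMap_injOn_Ioo hzn).image_eq_image_iff hXs
      (negSet_subset_Ioo hzn hYs)).1 habs')
  · exact Or.inr (((absMap_injOn_compl_Icc hzn).image_eq_image_iff hXs
      (negSet_subset_compl_Icc hzn hYs)).1 habs')
  · exact Or.inl (((absMap_injOn_compl_Icc hzn).image_eq_image_iff hXs hYs).1 habs)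
end

section
/- Let n be a positive integer, ε the identity of W_n, and ω = (1,2,...,n,-1,-2,...,-n) ∈ W_n. The map ι restricted to NC^B(n) has range equal to the interval [ε, ω] in W_n with respect to the partial order coming from (W_n, R_n), and ι is an order isomorphism from NC^B(n) (ordered by reverse refinement) onto [ε, ω]. -/
open scoped Classical

namespace NCPB

/-- The generating set `R_n` of the hyperoctahedral group: all transpositions `(i,-i)`
and all products `(i,j)(-i,-j)` with `|i| ≠ |j|`. -/
def Rn (n : ℕ) : Set (Equiv.Perm (Fin (2*n))) :=
  {ρ | (∃ i, ρ = Equiv.swap i (negMap n i)) ∨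
       (∃ i j, absMap n i ≠ absMap n j ∧
          ρ = Equiv.swap i j * Equiv.swap (negMap n i) (negMap n j))}

/-- Membership in the hyperoctahedral group `W_n`: permutations of `[±n]` commuting
with the inversion map. -/
def InWn (n : ℕ) (τ : Equiv.Perm (Fin (2*n))) : Prop :=
  ∀ k, τ (negMap n k) = negMap n (τ k)

/-- Word-length with respect to the generating set `R_n`. -/
noncomputable def lenB (n : ℕ) (τ : Equiv.Perm (Fin (2*n))) : ℕ :=
  sInf {k | ∃ l : List (Equiv.Perm (Fin (2*n))),
    (∀ ρ ∈ l, ρ ∈ Rn n) ∧ l.length = k ∧ l.prod = τ}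

/-- The partial order on `W_n` coming from `(W_n, R_n)`: `a ≤ b` iff `|a| + |a⁻¹b| = |b|`. -/
def leB (n : ℕ) (a b : Equiv.Perm (Fin (2*n))) : Prop :=
  lenB n a + lenB n (a⁻¹ * b) = lenB n b

/-- `b` covers `a` in the partial order coming from `(W_n, R_n)`. -/
def CoversB (n : ℕ) (a b : Equiv.Perm (Fin (2*n))) : Prop :=
  leB n a b ∧ lenB n b = lenB n a + 1

/-- The orbits of a permutation. -/
def orbitsOf (n : ℕ) (τ : Equiv.Perm (Fin (2*n))) : Set (Set (Fin (2*n))) :=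
  {O | ∃ x, O = {y | τ.SameCycle x y}}

/-- Word-length with respect to the set of all transpositions of a symmetric group. -/
noncomputable def lenA (N : ℕ) (τ : Equiv.Perm (Fin N)) : ℕ :=
  sInf {k | ∃ l : List (Equiv.Perm (Fin N)),
    (∀ ρ ∈ l, ρ.IsSwap) ∧ l.length = k ∧ l.prod = τ}

/-- The partial order on the symmetric group coming from all transpositions. -/
def leA (N : ℕ) (a b : Equiv.Perm (Fin N)) : Prop :=
  lenA N a + lenA N (a⁻¹ * b) = lenA N b

/-- `τ = ι(π)`: for each block `B` of `π` and `a ∈ B`, `τ a` is the cyclic successor of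
`a` in `B` (the least element of `B` greater than `a`, or the least element of `B` if
`a` is the largest element of `B`). -/
def IsIota (N : ℕ) (π : Set (Set (Fin N))) (τ : Equiv.Perm (Fin N)) : Prop :=
  ∀ B ∈ π, ∀ a ∈ B,
    ((∃ b ∈ B, a < b) → IsLeast {b | b ∈ B ∧ a < b} (τ a)) ∧
    ((∀ b ∈ B, ¬ a < b) → IsLeast B (τ a))

/-- The long inversion-invariant cycle `ω = (1, 2, ..., n, -1, -2, ..., -n)`. -/
def omegaW (n : ℕ) : Equiv.Perm (Fin (2*n)) := finRotate (2*n)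

end NCPB
namespace NCPB

variable {n : ℕ} {r r₁ r₂ : Fin (2*n) → Fin (2*n) → Prop} {τ τ₁ τ₂ : Equiv.Perm (Fin (2*n))}

lemma negMap_val (k : Fin (2*n)) :
    (negMap n k).val = if k.val < n then k.val + n else k.val - n := by
  have := k.isLt
  simp only [negMap]
  split_ifs with h
  · exact Nat.mod_eq_of_lt (by omega)
  · rw [Nat.mod_eq_sub_mod (by omega), Nat.mod_eq_of_lt (by omega)]; omega

lemma negMap_negMap (k : Fin (2*n)) : negMap n (negMap n k) = k := by
  have := k.isLt
  apply Fin.ext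
  rw [negMap_val, negMap_val]
  split_ifs <;> omega

lemma negMap_ne (k : Fin (2*n)) : negMap n k ≠ k := by
  have := k.isLt
  intro h
  have := congrArg Fin.val h
  rw [negMap_val] at this
  split_ifs at this <;> omega

lemma negMap_inj {a b : Fin (2*n)} : negMap n a = negMap n b ↔ a = b :=
  ⟨fun h => by rw [← negMap_negMap a, h, negMap_negMap], fun h => h ▸ rfl⟩

lemma absMap_eq_iff (a b : Fin (2*n)) : absMap n a = absMap n b ↔ a = b ∨ negMap n a = b := by
  have ha := a.isLt
  have hb := b.isLt
  have hmod : ∀ k : Fin (2*n), k.val % n = if k.val < n then k.val else k.val - n := by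
    intro k
    have := k.isLt
    split_ifs with h
    · exact Nat.mod_eq_of_lt h
    · rw [Nat.mod_eq_sub_mod (by omega), Nat.mod_eq_of_lt (by omega)]
  rw [Fin.ext_iff, Fin.ext_iff, Fin.ext_iff, negMap_val]
  simp only [absMap, hmod]
  split_ifs <;> omega

/-- The chord joining `i` and `j` separates the circle into two half-open arcs;
`OnArc i j` is the one avoiding the least element of the linear order. -/
def OnArc (i j x : Fin (2*n)) : Prop := (i < x ∧ x ≤ j) ∨ (j < x ∧ x ≤ i)

lemma onArc_comm (i j x : Fin (2*n)) : OnArc i j x ↔ OnArc j i x := by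
  unfold OnArc; tauto

lemma onArc_negMap (i j x y : Fin (2*n)) :
    (OnArc (negMap n i) (negMap n j) (negMap n x) ↔
      OnArc (negMap n i) (negMap n j) (negMap n y)) ↔ (OnArc i j x ↔ OnArc i j y) := by
  have := i.isLt
  have := j.isLt
  have := x.isLt
  have := y.isLt
  simp only [OnArc, Fin.lt_def, Fin.le_def, negMap_val]
  split_ifs <;> omega

/-- `z` lies on the open arc going clockwise from `x` to `y`. -/
def OpenArc (x y z : Fin (2*n)) : Prop := (x < y ∧ x < z ∧ z < y) ∨ (y ≤ x ∧ (x < z ∨ z < y))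

/-- `r` is a non-crossing equivalence relation on `[±n]` and `τ` sends every point to the
cyclic successor in its class. -/
structure IsNCPerm (r : Fin (2*n) → Fin (2*n) → Prop) (τ : Equiv.Perm (Fin (2*n))) : Prop where
  equiv : Equivalence r
  nc : ∀ a b c d, a < b → b < c → c < d → r a c → r b d → r a b
  rel : ∀ x, r x (τ x)
  arc : ∀ x z, r x z → ¬ OpenArc x (τ x) z

/-- Invariance of a relation on `[±n]` under the inversion map. -/
def NegInvariant (r : Fin (2*n) → Fin (2*n) → Prop) : Prop :=
  ∀ x y, r x y → r (negMap n x) (negMap n y)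

/-- The relation obtained from `r` by cutting along the chord joining `i` and `j`. -/
def cutRel (r : Fin (2*n) → Fin (2*n) → Prop) (i j : Fin (2*n)) : Fin (2*n) → Fin (2*n) → Prop :=
  fun x y => r x y ∧ (OnArc i j x ↔ OnArc i j y)

/-- Two chords of a non-crossing relation do not cross, in cyclic form. -/
lemma IsNCPerm.onArc_iff (h : IsNCPerm r τ) {i j x y : Fin (2*n)} (hij : r i j) (hxy : r x y)
    (hix : ¬ r i x) : OnArc i j x ↔ OnArc i j y := by
  have hs := @h.equiv.symm
  have ht := @h.equiv.trans
  have hyx := hs hxy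
  have hji := hs hij
  have hxi' : ¬ r x i := fun e => hix (hs e)
  have hyi' : ¬ r y i := fun e => hxi' (ht hxy e)
  have hjx' : ¬ r j x := fun e => hix (ht hij e)
  have hjy' : ¬ r j y := fun e => hjx' (ht e hyx)
  have hiy' : ¬ r i y := fun e => hyi' (hs e)
  have hne : ∀ {a b}, ¬ r a b → a ≠ b := fun hab e => hab (e ▸ h.equiv.refl _)
  have hni := hne hxi'
  have hnj := hne hjx'
  have hni' := hne hyi'
  have hnj' := hne hjy'
  have nc : ∀ a b c d, r a c → r b d → ¬ r a b → ¬ (a < b ∧ b < c ∧ c < d) :=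
    fun a b c d hac hbd hab hlt => hab (h.nc a b c d hlt.1 hlt.2.1 hlt.2.2 hac hbd)
  have c1 := nc i x j y hij hxy hix
  have c2 := nc i y j x hij hyx hiy'
  have c3 := nc j x i y hji hxy hjx'
  have c4 := nc j y i x hji hyx hjy'
  have c5 := nc x i y j hxy hij hxi'
  have c6 := nc x j y i hxy hji (fun e => hjx' (hs e))
  have c7 := nc y i x j hyx hij hyi'
  have c8 := nc y j x i hyx hji (fun e => hjy' (hs e))
  simp only [OnArc, Fin.lt_def, Fin.le_def, ne_eq, Fin.ext_iff] at *
  omega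

lemma IsNCPerm.cut_of_lt (h : IsNCPerm r τ) {i j : Fin (2*n)} (hij : r i j) (hlt : i < j) :
    IsNCPerm (cutRel r i j) (τ * Equiv.swap i j) := by
  have hs := @h.equiv.symm
  have ht := @h.equiv.trans
  have harc := h.arc
  have harcj := h.arc j i (hs hij)
  have harci := h.arc i j hij
  refine ⟨⟨fun x => ⟨h.equiv.refl x, Iff.rfl⟩, fun hxy => ⟨hs hxy.1, hxy.2.symm⟩,
    fun hxy hyz => ⟨ht hxy.1 hyz.1, hxy.2.trans hyz.2⟩⟩, ?_, ?_, ?_⟩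
  · rintro a b c d hab hbc hcd ⟨hac, hac'⟩ ⟨hbd, hbd'⟩
    refine ⟨h.nc a b c d hab hbc hcd hac hbd, ?_⟩
    simp only [OnArc, Fin.lt_def, Fin.le_def] at *
    omega
  · intro x
    rcases eq_or_ne x i with rfl | hxi
    · rw [Equiv.Perm.mul_apply, Equiv.swap_apply_left]
      refine ⟨ht hij (h.rel j), ?_⟩
      simp only [OnArc, OpenArc, Fin.lt_def, Fin.le_def] at *
      omega
    rcases eq_or_ne x j with rfl | hxj
    · rw [Equiv.Perm.mul_apply, Equiv.swap_apply_right]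
      refine ⟨ht (hs hij) (h.rel i), ?_⟩
      simp only [OnArc, OpenArc, Fin.lt_def, Fin.le_def] at *
      omega
    rw [Equiv.Perm.mul_apply, Equiv.swap_apply_of_ne_of_ne hxi hxj]
    refine ⟨h.rel x, ?_⟩
    by_cases hix : r i x
    · have h1 := h.arc x i (hs hix)
      have h2 := h.arc x j (ht (hs hix) hij)
      simp only [OnArc, OpenArc, Fin.lt_def, Fin.le_def, ne_eq, Fin.ext_iff] at *
      omega
    · exact h.onArc_iff hij (h.rel x) hix
  · rintro x z ⟨hxz, hxz'⟩
    rcases eq_or_ne x i with rfl | hxi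
    · rw [Equiv.Perm.mul_apply, Equiv.swap_apply_left]
      have := h.arc j z (ht (hs hij) hxz)
      simp only [OnArc, OpenArc, Fin.lt_def, Fin.le_def] at *
      omega
    rcases eq_or_ne x j with rfl | hxj
    · rw [Equiv.Perm.mul_apply, Equiv.swap_apply_right]
      have := h.arc i z (ht hij hxz)
      simp only [OnArc, OpenArc, Fin.lt_def, Fin.le_def] at *
      omega
    rw [Equiv.Perm.mul_apply, Equiv.swap_apply_of_ne_of_ne hxi hxj]
    exact h.arc x z hxz

lemma IsNCPerm.cut (h : IsNCPerm r τ) {i j : Fin (2*n)} (hij : r i j) (hne : i ≠ j) :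
    IsNCPerm (cutRel r i j) (τ * Equiv.swap i j) := by
  rcases lt_or_gt_of_ne hne with hlt | hlt
  · exact h.cut_of_lt hij hlt
  · have := h.cut_of_lt (h.equiv.symm hij) hlt
    rw [Equiv.swap_comm]
    convert this using 1
    funext x y
    simp only [cutRel, onArc_comm i j]

/-- The relation obtained from `r` by cutting along the chord joining `i` and `j` and the chord
joining `-i` and `-j`. -/
def cutRelB (r : Fin (2*n) → Fin (2*n) → Prop) (i j : Fin (2*n)) :
    Fin (2*n) → Fin (2*n) → Prop :=
  cutRel (cutRel r i j) (negMap n i) (negMap n j)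

lemma NegInvariant.cutRelB (hr : NegInvariant r) (i j : Fin (2*n)) :
    NegInvariant (cutRelB r i j) := by
  rintro x y ⟨⟨h1, h2⟩, h3⟩
  refine ⟨⟨hr x y h1, ?_⟩, (onArc_negMap i j x y).2 h2⟩
  have := (onArc_negMap (negMap n i) (negMap n j) x y).2 h3
  rwa [negMap_negMap, negMap_negMap] at this

/-- The reflection in `R_n` exchanging `i` and `j`. -/
noncomputable def reflB (i j : Fin (2*n)) : Equiv.Perm (Fin (2*n)) :=
  if j = negMap n i then Equiv.swap i j
  else Equiv.swap i j * Equiv.swap (negMap n i) (negMap n j)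

lemma reflB_mem {i j : Fin (2*n)} (hne : i ≠ j) : reflB i j ∈ Rn n := by
  unfold reflB
  split_ifs with h
  · exact Or.inl ⟨i, by rw [h]⟩
  · refine Or.inr ⟨i, j, ?_, rfl⟩
    rw [Ne, absMap_eq_iff]
    rintro (e | e)
    · exact hne e
    · exact h e.symm

lemma mem_Rn_iff {ρ : Equiv.Perm (Fin (2*n))} : ρ ∈ Rn n ↔ ∃ i j, i ≠ j ∧ ρ = reflB i j := by
  constructor
  · rintro (⟨i, rfl⟩ | ⟨i, j, hij, rfl⟩)
    · exact ⟨i, negMap n i, (negMap_ne i).symm, by simp [reflB]⟩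
    · rw [Ne, absMap_eq_iff, not_or] at hij
      exact ⟨i, j, hij.1, by rw [reflB, if_neg (fun e => hij.2 e.symm)]⟩
  · rintro ⟨i, j, hne, rfl⟩
    exact reflB_mem hne

lemma reflB_apply_left (i j : Fin (2*n)) : reflB i j i = j := by
  unfold reflB
  split_ifs with h
  · exact Equiv.swap_apply_left i j
  · rw [Equiv.Perm.mul_apply, Equiv.swap_apply_of_ne_of_ne (negMap_ne i).symm,
      Equiv.swap_apply_left]
    intro e
    exact h (by rw [e, negMap_negMap])

lemma inv_mem_Rn {ρ : Equiv.Perm (Fin (2*n))} (h : ρ ∈ Rn n) : ρ⁻¹ ∈ Rn n := by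
  rcases h with ⟨i, rfl⟩ | ⟨i, j, hij, rfl⟩
  · exact Or.inl ⟨i, by simp⟩
  · refine Or.inr ⟨negMap n i, negMap n j, ?_, by simp [negMap_negMap]⟩
    rw [Ne, absMap_eq_iff] at hij ⊢
    rwa [negMap_inj, negMap_inj]

lemma IsNCPerm.cutB (h : IsNCPerm r τ) (hr : NegInvariant r) {i j : Fin (2*n)} (hij : r i j)
    (hne : i ≠ j) : IsNCPerm (cutRelB r i j) (τ * reflB i j) := by
  have h1 := h.cut hij hne
  unfold reflB
  split_ifs with hj
  · convert h1 using 1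
    funext x y
    subst hj
    simp only [cutRelB, cutRel, negMap_negMap, onArc_comm (negMap n i) i, and_assoc, and_self]
  · rw [← mul_assoc]
    refine h1.cut ⟨hr _ _ hij, ?_⟩ (fun e => hne (negMap_inj.1 e))
    have := i.isLt
    have := j.isLt
    rw [Fin.ext_iff, negMap_val] at hj
    rw [Ne, Fin.ext_iff] at hne
    simp only [OnArc, Fin.lt_def, Fin.le_def, negMap_val]
    split_ifs at * <;> omega

lemma IsNCPerm.one : IsNCPerm (n := n) (fun x y => x = y) 1 := by
  refine ⟨eq_equivalence, ?_, fun _ => rfl, ?_⟩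
  · rintro a b c d hab hbc - rfl
    exact absurd (hab.trans hbc) (lt_irrefl _)
  · rintro x z rfl
    simp [OpenArc]

lemma finRotate_val (k : Fin (2*n)) :
    (finRotate (2*n) k).val = if k.val + 1 = 2*n then 0 else k.val + 1 := by
  obtain ⟨m, hm⟩ : ∃ m, 2*n = m + 1 := ⟨2*n - 1, by have := k.isLt; omega⟩
  generalize 2*n = N at *
  subst hm
  rw [coe_finRotate]
  simp [Fin.ext_iff]

lemma IsNCPerm.omegaW : IsNCPerm (fun _ _ => True) (omegaW n) := by
  refine ⟨⟨fun _ => trivial, fun _ => trivial, fun _ _ => trivial⟩,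
    fun _ _ _ _ _ _ _ _ _ => trivial,
    fun _ => trivial, ?_⟩
  intro x z _
  have := x.isLt
  have := z.isLt
  simp only [OpenArc, NCPB.omegaW, Fin.lt_def, Fin.le_def, finRotate_val]
  split_ifs <;> omega

/-- The odd functions on `[±n]` fixed by `τ`, i.e. the fixed space of `τ` in the
reflection representation of `W_n`. -/
def fixedOdd (τ : Equiv.Perm (Fin (2*n))) : Submodule ℚ (Fin (2*n) → ℚ) where
  carrier := {f | (∀ x, f (negMap n x) = - f x) ∧ ∀ x, f (τ x) = f x}
  add_mem' hf hg := ⟨fun x => by simp only [Pi.add_apply, hf.1 x, hg.1 x]; ring,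
    fun x => by simp only [Pi.add_apply, hf.2 x, hg.2 x]⟩
  zero_mem' := ⟨fun x => by simp, fun x => rfl⟩
  smul_mem' c f hf := ⟨fun x => by simp only [Pi.smul_apply, hf.1 x, smul_neg],
    fun x => by simp only [Pi.smul_apply, hf.2 x]⟩

lemma fixedOdd_le_one : fixedOdd τ ≤ fixedOdd 1 := fun _ hf => ⟨hf.1, fun _ => rfl⟩

lemma fixedOdd_inf_le_mul : fixedOdd τ₁ ⊓ fixedOdd τ₂ ≤ fixedOdd (τ₁ * τ₂) := by
  rintro f ⟨h1, h2⟩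
  exact ⟨h1.1, fun x => by rw [Equiv.Perm.mul_apply, h1.2, h2.2]⟩

lemma fixedOdd_mul_inf_le : fixedOdd (τ₁ * τ₂) ⊓ fixedOdd τ₂ ≤ fixedOdd τ₁ := by
  rintro f ⟨h1, h2⟩
  refine ⟨h1.1, fun x => ?_⟩
  obtain ⟨y, rfl⟩ := τ₂.surjective x
  rw [h2.2, ← h1.2 y, Equiv.Perm.mul_apply]

lemma mem_fixedOdd_reflB {f : Fin (2*n) → ℚ} (hf : ∀ x, f (negMap n x) = - f x)
    {i j : Fin (2*n)} (hij : f i = f j) : f ∈ fixedOdd (reflB i j) := by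
  have key : ∀ a b, f a = f b → ∀ x, f (Equiv.swap a b x) = f x := by
    intro a b hab x
    rcases eq_or_ne x a with rfl | ha
    · rw [Equiv.swap_apply_left, hab]
    rcases eq_or_ne x b with rfl | hb
    · rw [Equiv.swap_apply_right, hab]
    · rw [Equiv.swap_apply_of_ne_of_ne ha hb]
  refine ⟨hf, fun x => ?_⟩
  unfold reflB
  split_ifs
  · exact key i j hij x
  · rw [Equiv.Perm.mul_apply, key i j hij, key _ _ (by rw [hf, hf, hij])]

lemma finrank_le_inf_reflB (S : Submodule ℚ (Fin (2*n) → ℚ)) (hS : S ≤ fixedOdd 1)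
    (i j : Fin (2*n)) :
    Module.finrank ℚ S ≤ Module.finrank ℚ ↥(S ⊓ fixedOdd (reflB i j)) + 1 := by
  let φ : (Fin (2*n) → ℚ) →ₗ[ℚ] ℚ :=
    LinearMap.proj (R := ℚ) (φ := fun _ => ℚ) i - LinearMap.proj (R := ℚ) (φ := fun _ => ℚ) j
  have h1 := (φ.domRestrict S).finrank_range_add_finrank_ker
  have h2 : Module.finrank ℚ (LinearMap.range (φ.domRestrict S)) ≤ 1 :=
    (Submodule.finrank_le _).trans (by simp)
  have h3 : Module.finrank ℚ (LinearMap.ker (φ.domRestrict S)) ≤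
      Module.finrank ℚ ↥(S ⊓ fixedOdd (reflB i j)) := by
    rw [← Submodule.finrank_map_subtype_eq]
    apply Submodule.finrank_mono
    rintro _ ⟨⟨f, hfS⟩, hf, rfl⟩
    exact ⟨hfS, mem_fixedOdd_reflB (hS hfS).1 (sub_eq_zero.1 hf)⟩
  omega

lemma finrank_le_inf_prod {l : List (Equiv.Perm (Fin (2*n)))} (hl : ∀ ρ ∈ l, ρ ∈ Rn n)
    (S : Submodule ℚ (Fin (2*n) → ℚ)) (hS : S ≤ fixedOdd 1) :
    Module.finrank ℚ S ≤ Module.finrank ℚ ↥(S ⊓ fixedOdd l.prod) + l.length := by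
  induction l generalizing S with
  | nil => rw [List.prod_nil, inf_eq_left.2 hS, List.length_nil, add_zero]
  | cons ρ l ih =>
    obtain ⟨i, j, -, hρ⟩ := mem_Rn_iff.1 (hl ρ (by simp))
    have h1 := finrank_le_inf_reflB S hS i j
    rw [← hρ] at h1
    have h2 := ih (fun σ hσ => hl σ (by simp [hσ])) (S ⊓ fixedOdd ρ) (inf_le_left.trans hS)
    have h3 : S ⊓ fixedOdd ρ ⊓ fixedOdd l.prod ≤ S ⊓ fixedOdd (ρ :: l).prod := by
      rw [inf_assoc, List.prod_cons]
      exact inf_le_inf_left S fixedOdd_inf_le_mul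
    have h4 := Submodule.finrank_mono h3
    rw [List.length_cons]
    omega

/-- The dimension of the fixed space of `τ`. -/
noncomputable def fixDim (τ : Equiv.Perm (Fin (2*n))) : ℕ := Module.finrank ℚ (fixedOdd τ)

lemma fixDim_one_le {l : List (Equiv.Perm (Fin (2*n)))} (hl : ∀ ρ ∈ l, ρ ∈ Rn n) :
    fixDim (n := n) 1 ≤ fixDim l.prod + l.length := by
  have := finrank_le_inf_prod hl (fixedOdd 1) le_rfl
  rwa [inf_eq_right.2 fixedOdd_le_one] at this

lemma fixDim_mul_le {l : List (Equiv.Perm (Fin (2*n)))} (hl : ∀ ρ ∈ l, ρ ∈ Rn n) :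
    fixDim (τ * l.prod) ≤ fixDim τ + l.length := by
  have := finrank_le_inf_prod hl (fixedOdd (τ * l.prod)) fixedOdd_le_one
  exact this.trans (Nat.add_le_add_right (Submodule.finrank_mono fixedOdd_mul_inf_le) _)

/-- `τ` is a product of `k` elements of `R_n`. -/
def IsWord (k : ℕ) (τ : Equiv.Perm (Fin (2*n))) : Prop :=
  ∃ l : List (Equiv.Perm (Fin (2*n))), (∀ ρ ∈ l, ρ ∈ Rn n) ∧ l.length = k ∧ l.prod = τ

lemma IsWord.mul {k m : ℕ} (h₁ : IsWord k τ₁) (h₂ : IsWord m τ₂) : IsWord (k + m) (τ₁ * τ₂) := by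
  obtain ⟨l, hl, rfl, rfl⟩ := h₁
  obtain ⟨l', hl', rfl, rfl⟩ := h₂
  refine ⟨l ++ l', ?_, by simp, by simp⟩
  simp only [List.mem_append]
  rintro ρ (h | h)
  exacts [hl ρ h, hl' ρ h]

lemma IsWord.inv {k : ℕ} (h : IsWord k τ) : IsWord k τ⁻¹ := by
  obtain ⟨l, hl, rfl, rfl⟩ := h
  refine ⟨(l.map (·⁻¹)).reverse, ?_, by simp, (List.prod_inv_reverse l).symm⟩
  simp only [List.mem_reverse, List.mem_map]
  rintro _ ⟨ρ, hρ, rfl⟩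
  exact inv_mem_Rn (hl ρ hρ)

lemma IsWord.fixDim_mul_le {k : ℕ} (h : IsWord k τ) (σ : Equiv.Perm (Fin (2*n))) :
    fixDim (σ * τ) ≤ fixDim σ + k := by
  obtain ⟨l, hl, rfl, rfl⟩ := h
  exact NCPB.fixDim_mul_le hl

lemma IsWord.lenB_le {k : ℕ} (h : IsWord k τ) : lenB n τ ≤ k := Nat.sInf_le h

lemma IsWord.lenB {k : ℕ} (h : IsWord k τ) : IsWord (lenB n τ) τ :=
  Nat.sInf_mem (s := {k | IsWord k τ}) ⟨k, h⟩

lemma lenB_eq_zero_of_not_isWord (h : ∀ k, ¬ IsWord k τ) : lenB n τ = 0 := by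
  have : {k | IsWord k τ} = ∅ := Set.eq_empty_of_forall_notMem h
  exact (congrArg sInf this).trans Nat.sInf_empty

lemma IsWord.fixDim_one_le {k : ℕ} (h : IsWord k τ) : fixDim (n := n) 1 ≤ fixDim τ + k := by
  obtain ⟨l, hl, rfl, rfl⟩ := h
  exact NCPB.fixDim_one_le hl

lemma lenB_one : lenB n 1 = 0 :=
  Nat.le_zero.1 (IsWord.lenB_le ⟨[], by simp, rfl, rfl⟩)

/-- A function fixed by `τ` is constant on the classes of `r`. -/
lemma IsNCPerm.eq_of_rel (h : IsNCPerm r τ) {f : Fin (2*n) → ℚ} (hf : ∀ x, f (τ x) = f x)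
    {x y : Fin (2*n)} (hxy : r x y) : f x = f y := by
  have key : ∀ d : ℕ, ∀ x y : Fin (2*n), r x y → x ≤ y → y.val - x.val = d → f x = f y := by
    intro d
    induction d using Nat.strong_induction_on with
    | _ d ih =>
      intro x y hxy hle hd
      rcases eq_or_ne x y with rfl | hne
      · rfl
      have harc := h.arc x y hxy
      have hlt : x < τ x ∧ τ x ≤ y := by
        simp only [OpenArc, Fin.lt_def, Fin.le_def, ne_eq, Fin.ext_iff] at *
        omega
      rw [← hf x]
      refine ih (y.val - (τ x).val) ?_ (τ x) y
        (h.equiv.trans (h.equiv.symm (h.rel x)) hxy) hlt.2 rfl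
      simp only [Fin.lt_def, Fin.le_def] at *
      omega
  rcases le_total x y with hle | hle
  · exact key _ x y hxy hle rfl
  · exact (key _ y x (h.equiv.symm hxy) hle rfl).symm

/-- Two points related to their negatives are related to each other: the zero block is unique. -/
lemma IsNCPerm.rel_of_rel_negMap (h : IsNCPerm r τ) {i j : Fin (2*n)}
    (hi : r i (negMap n i)) (hj : r j (negMap n j)) : r i j := by
  by_contra hij
  have h1 := h.onArc_iff hi hj hij
  have hne : i ≠ j := fun e => hij (e ▸ h.equiv.refl _)
  have hne' : j ≠ negMap n i := fun e => hij (e ▸ hi)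
  have := i.isLt
  have := j.isLt
  rw [Ne, Fin.ext_iff, negMap_val] at hne'
  simp only [OnArc, Fin.lt_def, Fin.le_def, negMap_val, ne_eq, Fin.ext_iff] at *
  split_ifs at * <;> omega

/-- The functions fixed by `τ` separate the classes of `r`. -/
lemma IsNCPerm.rel_of_forall_eq (h : IsNCPerm r τ) (hr : NegInvariant r) {i j : Fin (2*n)}
    (hf : ∀ f ∈ fixedOdd τ, f i = f j) : r i j := by
  have hs := @h.equiv.symm
  have ht := @h.equiv.trans
  have hrn : ∀ x y, r x (negMap n y) ↔ r (negMap n x) y := fun x y =>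
    ⟨fun e => by simpa [negMap_negMap] using hr _ _ e,
      fun e => by simpa [negMap_negMap] using hr _ _ e⟩
  have hmem : ∀ a, (fun z => (if r a z then (1:ℚ) else 0) - if r (negMap n a) z then 1 else 0)
      ∈ fixedOdd τ := by
    intro a
    refine ⟨fun x => ?_, fun x => ?_⟩
    · simp only [hrn, negMap_negMap, neg_sub]
    · have : ∀ b, r b (τ x) ↔ r b x := fun b => ⟨fun e => ht e (hs (h.rel x)),
        fun e => ht e (h.rel x)⟩
      simp only [this]
  by_cases hi : r (negMap n i) i
  · by_cases hj : r (negMap n j) j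
    · exact h.rel_of_rel_negMap (hs hi) (hs hj)
    · have := hf _ (hmem j)
      simp only [h.equiv.refl j, hj, if_true, if_false] at this
      by_contra hij
      rw [if_neg (fun e => hij (hs e))] at this
      split_ifs at this <;> norm_num at this
  · have := hf _ (hmem i)
    simp only [h.equiv.refl i, hi, if_true, if_false] at this
    by_contra hij
    rw [if_neg hij] at this
    split_ifs at this <;> norm_num at this

lemma IsNCPerm.fixDim_lt_cutB (h : IsNCPerm r τ) (hr : NegInvariant r) {i j : Fin (2*n)}
    (hij : r i j) (hne : i ≠ j) : fixDim τ < fixDim (τ * reflB i j) := by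
  apply Submodule.finrank_lt_finrank_of_lt
  have hcut := h.cutB hr hij hne
  have hρ : fixedOdd τ ≤ fixedOdd (reflB i j) := fun f hf =>
    mem_fixedOdd_reflB hf.1 (h.eq_of_rel hf.2 hij)
  refine lt_of_le_not_ge ((le_inf le_rfl hρ).trans fixedOdd_inf_le_mul) fun hle => ?_
  have h1 : cutRelB r i j i j := hcut.rel_of_forall_eq (hr.cutRelB i j) fun f hf =>
    h.eq_of_rel (hle hf).2 hij
  have h2 := h1.1.2
  simp only [OnArc, Fin.lt_def, Fin.le_def, ne_eq, Fin.ext_iff] at *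
  omega

/-- Going down from `τ` along a reduced word one only meets non-crossing permutations. -/
lemma IsNCPerm.of_prod {l : List (Equiv.Perm (Fin (2*n)))} (hl : ∀ ρ ∈ l, ρ ∈ Rn n)
    (h : IsNCPerm r τ) (hr : NegInvariant r) (hd : fixDim τ + l.length ≤ fixDim (τ * l.prod)) :
    ∃ r', IsNCPerm r' (τ * l.prod) ∧ NegInvariant r' := by
  induction l generalizing r τ with
  | nil => exact ⟨r, by simpa using h, hr⟩
  | cons ρ l ih =>
    have hl' : ∀ σ ∈ l, σ ∈ Rn n := fun σ hσ => hl σ (by simp [hσ])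
    have hρ := hl ρ (by simp)
    obtain ⟨i, j, hne, hρij⟩ := mem_Rn_iff.1 hρ
    rw [List.prod_cons, ← mul_assoc, List.length_cons] at *
    have h1 := fixDim_mul_le (τ := τ * ρ) hl'
    have hw : IsWord 1 ρ := ⟨[ρ], by simpa using hρ, rfl, by simp⟩
    have h2 := hw.fixDim_mul_le τ
    have h3 : Module.finrank ℚ (fixedOdd (τ * ρ)) ≤
        Module.finrank ℚ ↥(fixedOdd (τ * ρ) ⊓ fixedOdd ρ) + 1 := by
      rw [hρij]
      exact finrank_le_inf_reflB _ fixedOdd_le_one i j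
    have h4 : fixedOdd (τ * ρ) ⊓ fixedOdd ρ = fixedOdd τ :=
      Submodule.eq_of_le_of_finrank_le fixedOdd_mul_inf_le (by unfold fixDim at *; omega)
    have hij : r i j := h.rel_of_forall_eq hr fun f hf => by
      rw [← h4] at hf
      have := hf.2.2 i
      rw [hρij, reflB_apply_left] at this
      exact this.symm
    have hcut := h.cutB hr hij hne
    rw [← hρij] at hcut
    exact ih hl' hcut (hr.cutRelB i j) (by omega)

/-- If `r₁` refines `r₂` then it also refines the relation obtained from `r₂` by cutting along
a chord which starts at `x` and isolates the arc between `x` and `τ₁ x`. -/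
lemma IsNCPerm.onArc_iff_of_refines (h₁ : IsNCPerm r₁ τ₁) (h₂ : IsNCPerm r₂ τ₂)
    (hle : ∀ x y, r₁ x y → r₂ x y) {x y : Fin (2*n)} (hxy : τ₂ y = τ₁ x) {a b : Fin (2*n)}
    (hab : r₁ a b) : OnArc x y a ↔ OnArc x y b := by
  have hs := @h₂.equiv.symm
  have ht := @h₂.equiv.trans
  have hyt : r₂ y (τ₁ x) := hxy ▸ h₂.rel y
  have hxt : r₂ x (τ₁ x) := hle _ _ (h₁.rel x)
  have hxy' : r₂ x y := ht hxt (hs hyt)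
  by_cases hxa : r₂ x a
  · have hxb := ht hxa (hle _ _ hab)
    have a1 := h₂.arc y a (ht (hs hxy') hxa)
    have a2 := h₂.arc y b (ht (hs hxy') hxb)
    have a3 := h₂.arc y x (hs hxy')
    rw [hxy] at a1 a2 a3
    by_cases hxa₁ : r₁ x a
    · have b1 := h₁.arc x a hxa₁
      have b2 := h₁.arc x b (h₁.equiv.trans hxa₁ hab)
      simp only [OnArc, OpenArc, Fin.lt_def, Fin.le_def] at *
      omega
    · have hc := h₁.onArc_iff (h₁.rel x) hab hxa₁
      have ha : a ≠ x := fun e => hxa₁ (e ▸ h₁.equiv.refl _)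
      have ha' : a ≠ τ₁ x := fun e => hxa₁ (e ▸ h₁.rel x)
      have hb : b ≠ x := fun e => hxa₁ (h₁.equiv.symm (e ▸ hab))
      have hb' : b ≠ τ₁ x := fun e => hxa₁ (h₁.equiv.trans (h₁.rel x) (h₁.equiv.symm (e ▸ hab)))
      simp only [OnArc, OpenArc, Fin.lt_def, Fin.le_def, ne_eq, Fin.ext_iff] at *
      omega
  · exact h₂.onArc_iff hxy' (hle _ _ hab) hxa

lemma IsNCPerm.exists_isWord (h₁ : IsNCPerm r₁ τ₁) (hr₁ : NegInvariant r₁) (h₂ : IsNCPerm r₂ τ₂)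
    (hr₂ : NegInvariant r₂) (hle : ∀ x y, r₁ x y → r₂ x y) :
    ∃ k, IsWord k (τ₁⁻¹ * τ₂) ∧ k + fixDim τ₂ ≤ fixDim τ₁ := by
  induction hm : 2 * n - fixDim τ₂ using Nat.strong_induction_on generalizing r₂ τ₂ with
  | _ m ih =>
    by_cases heq : τ₁ = τ₂
    · subst heq
      exact ⟨0, ⟨[], by simp, rfl, by simp⟩, by simp⟩
    obtain ⟨x, hx⟩ : ∃ x, τ₁ x ≠ τ₂ x := by
      by_contra! hc
      exact heq (Equiv.ext hc)
    obtain ⟨y, hy⟩ := τ₂.surjective (τ₁ x)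
    have hne : x ≠ y := fun e => hx (by rw [← hy, e])
    have hxy : r₂ x y :=
      h₂.equiv.trans (hle _ _ (h₁.rel x)) (h₂.equiv.symm (hy ▸ h₂.rel y))
    have hcut := h₂.cutB hr₂ hxy hne
    have hlt := h₂.fixDim_lt_cutB hr₂ hxy hne
    have hbd : fixDim (τ₂ * reflB x y) ≤ 2 * n :=
      (Submodule.finrank_le _).trans (by simp)
    have hle' : ∀ a b, r₁ a b → cutRelB r₂ x y a b := by
      intro a b hab
      refine ⟨⟨hle a b hab, h₁.onArc_iff_of_refines h₂ hle hy hab⟩, ?_⟩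
      have := h₁.onArc_iff_of_refines h₂ hle hy (hr₁ a b hab)
      rw [← onArc_negMap, negMap_negMap, negMap_negMap] at this
      exact this
    obtain ⟨k, hk, hkd⟩ := ih _ (by omega) hcut (hr₂.cutRelB x y) hle' rfl
    have hρ := inv_mem_Rn (reflB_mem hne)
    have hw : IsWord 1 (reflB x y)⁻¹ := ⟨[(reflB x y)⁻¹], by simpa using hρ, rfl, by simp⟩
    refine ⟨k + 1, ?_, by omega⟩
    have := hk.mul hw
    rwa [← mul_assoc, mul_inv_cancel_right] at this

lemma IsNCPerm.isWord (h : IsNCPerm r τ) (hr : NegInvariant r) :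
    ∃ k, IsWord k τ ∧ k + fixDim τ ≤ fixDim (n := n) 1 := by
  simpa using IsNCPerm.one.exists_isWord (fun _ _ e => congrArg _ e) h hr
    (fun x y e => e ▸ h.equiv.refl x)

lemma IsNCPerm.lenB_add (h : IsNCPerm r τ) (hr : NegInvariant r) :
    lenB n τ + fixDim τ = fixDim (n := n) 1 := by
  obtain ⟨k, hk, hkd⟩ := h.isWord hr
  have := hk.lenB_le
  have := hk.lenB.fixDim_one_le
  omega

lemma IsNCPerm.leB_of_refines (h₁ : IsNCPerm r₁ τ₁) (hr₁ : NegInvariant r₁)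
    (h₂ : IsNCPerm r₂ τ₂) (hr₂ : NegInvariant r₂) (hle : ∀ x y, r₁ x y → r₂ x y) :
    leB n τ₁ τ₂ := by
  obtain ⟨k, hk, hkd⟩ := h₁.exists_isWord hr₁ h₂ hr₂ hle
  obtain ⟨m, hm, -⟩ := h₁.isWord hr₁
  have e1 := h₁.lenB_add hr₁
  have e2 := h₂.lenB_add hr₂
  have e3 := hk.lenB_le
  have e4 := (hm.lenB.mul hk.lenB).lenB_le
  rw [mul_inv_cancel_left] at e4
  unfold leB
  omega

lemma IsNCPerm.refines_of_leB (h₁ : IsNCPerm r₁ τ₁) (hr₁ : NegInvariant r₁)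
    (h₂ : IsNCPerm r₂ τ₂) (hr₂ : NegInvariant r₂) (hle : leB n τ₁ τ₂) {x y : Fin (2*n)}
    (hxy : r₁ x y) : r₂ x y := by
  obtain ⟨k, hk, -⟩ := h₁.isWord hr₁
  obtain ⟨m, hm, -⟩ := h₂.isWord hr₂
  have e1 := h₁.lenB_add hr₁
  have e2 := h₂.lenB_add hr₂
  obtain ⟨l, hl, hlen, hprod⟩ := (hk.inv.mul hm).lenB
  have e3 := finrank_le_inf_prod hl (fixedOdd τ₁) fixedOdd_le_one
  rw [hprod, hlen] at e3
  have hinf : fixedOdd τ₁ ⊓ fixedOdd (τ₁⁻¹ * τ₂) ≤ fixedOdd τ₂ := by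
    simpa using fixedOdd_inf_le_mul (τ₁ := τ₁) (τ₂ := τ₁⁻¹ * τ₂)
  have heq := Submodule.eq_of_le_of_finrank_le hinf (by unfold leB fixDim at *; omega)
  refine h₂.rel_of_forall_eq hr₂ fun f hf => ?_
  rw [← heq] at hf
  exact h₁.eq_of_rel hf.1.2 hxy

lemma exists_isNCPerm_of_leB_omegaW (hn : 0 < n) (hle : leB n τ (omegaW n)) :
    ∃ r, IsNCPerm r τ ∧ NegInvariant r := by
  have hω := IsNCPerm.omegaW (n := n)
  have hrω : NegInvariant (n := n) fun _ _ => True := fun _ _ _ => trivial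
  obtain ⟨m, hm, -⟩ := hω.isWord hrω
  have hd := hω.lenB_add hrω
  unfold leB at hle
  have hw : ∃ k, IsWord k τ := by
    by_contra! hc
    have hc' : ∀ k, ¬ IsWord k (τ⁻¹ * omegaW n) := fun k hk => hc _ <| by
      simpa using hm.mul hk.inv
    rw [lenB_eq_zero_of_not_isWord hc, lenB_eq_zero_of_not_isWord hc'] at hle
    have hw := hm.lenB
    rw [← hle] at hw
    obtain ⟨l, -, hl0, hl1⟩ := hw
    rw [List.length_eq_zero_iff.1 hl0, List.prod_nil] at hl1
    have := congrArg Fin.val (congrArg (fun σ => σ ⟨0, by omega⟩) hl1)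
    simp only [omegaW, finRotate_val, Equiv.Perm.one_apply] at this
    split_ifs at this
    omega
  obtain ⟨k, hk⟩ := hw
  obtain ⟨l, hl, hlen, hprod⟩ := (hk.inv.mul hm).lenB.inv
  have hτ : omegaW n * l.prod = τ := by rw [hprod]; group
  have := hk.lenB.fixDim_one_le
  rw [← hτ]
  exact hω.of_prod hl hrω (by rw [hτ]; omega)

/-- The relation of lying in a common block of `π`. -/
def blockRel (π : Set (Set (Fin (2*n)))) (x y : Fin (2*n)) : Prop := ∃ B ∈ π, x ∈ B ∧ y ∈ B

variable {π π₁ π₂ : Set (Set (Fin (2*n)))}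

lemma blockRel_iff (hπ : IsPartition π) {B : Set (Fin (2*n))} (hB : B ∈ π) {x y : Fin (2*n)}
    (hx : x ∈ B) : blockRel π x y ↔ y ∈ B := by
  constructor
  · rintro ⟨C, hC, hxC, hyC⟩
    rwa [(hπ.2 x).unique ⟨hB, hx⟩ ⟨hC, hxC⟩]
  · exact fun hy => ⟨B, hB, hx, hy⟩

lemma isNCPerm_blockRel (hπ : NCPart π) (hτ : IsIota (2*n) π τ) : IsNCPerm (blockRel π) τ := by
  have hex : ∀ x, ∃ B ∈ π, x ∈ B := fun x => (hπ.1.2 x).exists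
  refine ⟨⟨fun x => ?_, ?_, ?_⟩, ?_, fun x => ?_, fun x z hxz => ?_⟩
  · obtain ⟨B, hB, hx⟩ := hex x
    exact ⟨B, hB, hx, hx⟩
  · rintro x y ⟨B, hB, hx, hy⟩
    exact ⟨B, hB, hy, hx⟩
  · rintro x y z ⟨B, hB, hx, hy⟩ hyz
    exact ⟨B, hB, hx, (blockRel_iff hπ.1 hB hy).1 hyz⟩
  · rintro a b c d hab hbc hcd ⟨B, hB, ha, hc⟩ ⟨C, hC, hb, hd⟩
    exact ⟨B, hB, ha, hπ.2 B hB C hC a b c d hab hbc hcd ha hc hb hd⟩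
  · obtain ⟨B, hB, hx⟩ := hex x
    rw [blockRel_iff hπ.1 hB hx]
    by_cases h : ∃ b ∈ B, x < b
    · exact ((hτ B hB x hx).1 h).1.1
    · push Not at h
      exact ((hτ B hB x hx).2 fun b hb => not_lt.2 (h b hb)).1
  · obtain ⟨B, hB, hx, hz⟩ := hxz
    by_cases h : ∃ b ∈ B, x < b
    · obtain ⟨h1, h2⟩ := (hτ B hB x hx).1 h
      have h3 := h1.2
      rintro (⟨-, hxz, hz'⟩ | ⟨hle, -⟩)
      · exact absurd (h2 ⟨hz, hxz⟩) (not_le.2 hz')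
      · exact absurd h3 (not_lt.2 hle)
    · push Not at h
      obtain ⟨-, h2⟩ := (hτ B hB x hx).2 fun b hb => not_lt.2 (h b hb)
      rintro (⟨hlt, -, hz'⟩ | ⟨-, hxz | hz'⟩)
      · exact absurd (h2 hz) (not_le.2 hz')
      · exact absurd (h z hz) (not_le.2 hxz)
      · exact absurd (h2 hz) (not_le.2 hz')

lemma negInvariant_blockRel (hπ : NCBPart n π) : NegInvariant (blockRel π) := by
  rintro x y ⟨B, hB, hx, hy⟩
  exact ⟨_, hπ.2 B hB, ⟨x, hx, rfl⟩, ⟨y, hy, rfl⟩⟩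

lemma refines_iff_blockRel (h₁ : IsPartition π₁) (h₂ : IsPartition π₂) :
    Refines π₁ π₂ ↔ ∀ x y, blockRel π₁ x y → blockRel π₂ x y := by
  constructor
  · rintro h x y ⟨B, hB, hx, hy⟩
    obtain ⟨C, hC, hBC⟩ := h B hB
    exact ⟨C, hC, hBC hx, hBC hy⟩
  · intro h B hB
    obtain ⟨x, hx⟩ := h₁.1 B hB
    obtain ⟨C, hC, hxC, -⟩ := h x x ⟨B, hB, hx, hx⟩
    exact ⟨C, hC, fun y hy => (blockRel_iff h₂ hC hxC).1 (h x y ⟨B, hB, hx, hy⟩)⟩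

lemma IsNCPerm.exists_isIota (h : IsNCPerm r τ) (hr : NegInvariant r) :
    ∃ π, NCBPart n π ∧ IsIota (2*n) π τ := by
  have hs := @h.equiv.symm
  have ht := @h.equiv.trans
  refine ⟨{B | ∃ x, B = {y | r x y}}, ⟨⟨⟨?_, fun a => ?_⟩, ?_⟩, ?_⟩, ?_⟩
  · rintro _ ⟨x, rfl⟩
    exact ⟨x, h.equiv.refl x⟩
  · refine ⟨{y | r a y}, ⟨⟨a, rfl⟩, h.equiv.refl a⟩, ?_⟩
    rintro _ ⟨⟨x, rfl⟩, hx⟩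
    exact Set.ext fun y => ⟨fun hy => ht (hs hx) hy, fun hy => ht hx hy⟩
  · rintro _ ⟨x, rfl⟩ _ ⟨y, rfl⟩ a b c d hab hbc hcd ha hc hb hd
    exact ht ha (h.nc a b c d hab hbc hcd (ht (hs ha) hc) (ht (hs hb) hd))
  · rintro _ ⟨x, rfl⟩
    refine ⟨negMap n x, Set.ext fun y => ⟨?_, fun hy => ⟨negMap n y, ?_, negMap_negMap y⟩⟩⟩
    · rintro ⟨z, hz, rfl⟩
      exact hr _ _ hz
    · simpa [negMap_negMap] using hr _ _ hy
  · rintro _ ⟨x, rfl⟩ a ha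
    have hτa : r x (τ a) := ht ha (h.rel a)
    have harc : ∀ z, r x z → ¬ OpenArc a (τ a) z := fun z hz => h.arc a z (ht (hs ha) hz)
    refine ⟨?_, fun hb => ⟨hτa, fun z hz => ?_⟩⟩
    · rintro ⟨b, hb, hab⟩
      refine ⟨⟨hτa, ?_⟩, ?_⟩
      · by_contra hlt
        exact harc b hb (Or.inr ⟨not_lt.1 hlt, Or.inl hab⟩)
      · rintro z ⟨hz, haz⟩
        by_contra hlt
        refine harc z hz ?_
        simp only [OpenArc, Fin.lt_def, Fin.le_def] at *
        omega
    · by_contra hlt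
      exact harc z hz (Or.inr ⟨not_lt.1 (hb _ hτa), Or.inr (not_le.1 hlt)⟩)

end NCPB
open NCPB in
/-- The map `ι` is an order isomorphism from `NC^B(n)` (ordered by
reverse refinement) onto the interval `[ε, ω] ⊆ W_n`, where
`ω = (1,2,...,n,-1,-2,...,-n)`. -/
theorem iota_orderIso_NCB_interval (n : ℕ) (hn : 0 < n) :
    (∀ τ : Equiv.Perm (Fin (2*n)),
        (∃ π, NCBPart n π ∧ IsIota (2*n) π τ) ↔ (leB n 1 τ ∧ leB n τ (omegaW n))) ∧
    (∀ (π₁ π₂ : Set (Set (Fin (2*n)))) (τ₁ τ₂ : Equiv.Perm (Fin (2*n))),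
        NCBPart n π₁ → NCBPart n π₂ → IsIota (2*n) π₁ τ₁ → IsIota (2*n) π₂ τ₂ →
        (Refines π₁ π₂ ↔ leB n τ₁ τ₂)) := by
  refine ⟨fun τ => ⟨?_, fun h => ?_⟩, fun π₁ π₂ τ₁ τ₂ h₁ h₂ hτ₁ hτ₂ => ?_⟩
  · rintro ⟨π, hπ, hτ⟩
    refine ⟨by simp [leB, lenB_one], ?_⟩
    exact (isNCPerm_blockRel hπ.1 hτ).leB_of_refines (negInvariant_blockRel hπ) IsNCPerm.omegaW
      (fun _ _ _ => trivial) (fun _ _ _ => trivial)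
  · obtain ⟨r, hr, hneg⟩ := exists_isNCPerm_of_leB_omegaW hn h.2
    exact hr.exists_isIota hneg
  · have hr₁ := isNCPerm_blockRel h₁.1 hτ₁
    have hr₂ := isNCPerm_blockRel h₂.1 hτ₂
    rw [refines_iff_blockRel h₁.1.1 h₂.1.1]
    exact ⟨hr₁.leB_of_refines (negInvariant_blockRel h₁) hr₂ (negInvariant_blockRel h₂),
      fun hle _ _ hxy => hr₁.refines_of_leB (negInvariant_blockRel h₁) hr₂
        (negInvariant_blockRel h₂) hle hxy⟩
end
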